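/- There exists a set L of nested words over the 2-stack call-return alphabet with Σ_c^1={a}, Σ_r^1={ā}, Σ_c^2={b}, Σ_r^2={b̄}, Σ_int=∅ such that L is recognized by some 2-stack visibly pushdown automaton but the complement NW(Σ̃) \ L is not recognized by any 2-stack visibly pushdown automaton. Hence the class of 2VPA-recognizable nested-word languages is not closed under complementation. -/

import Mathlib

/-- The *kind* of a letter in a `K`-stack call-return alphabet: a call of some
stack `s`, a return of some stack `s`, or an internal action. -/
inductive CRKind (K : ℕ) where
  | call (s : Fin K)
  | ret (s : Fin K)
  | int

/-- A `K`-stack call-return alphabet over the letters `A`: every letter is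
(exclusively) a call of one stack, a return of one stack, or internal.  This
encodes the pairwise disjointness of the collection
`⟨{(Σ_c^s, Σ_r^s)}_{s∈[K]}, Σ_int⟩` together with `Σ` being their union. -/
structure CRAlphabet (K : ℕ) (A : Type) where
  kind : A → CRKind K

namespace CRAlphabet

variable {K : ℕ} {A : Type}

def callSet (h : CRAlphabet K A) (s : Fin K) : Set A := {a | h.kind a = .call s}
def retSet (h : CRAlphabet K A) (s : Fin K) : Set A := {a | h.kind a = .ret s}
def intSet (h : CRAlphabet K A) : Set A := {a | h.kind a = .int}

end CRAlphabet

/-- `s`-well-formed strings: generated by the grammar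
`A ::= aAb | AA | ε | c` with `a ∈ c`, `b ∈ r`, `c ∉ c ∪ r`. -/
inductive SWellFormed {A : Type} (c r : Set A) : List A → Prop where
  | nil : SWellFormed c r []
  | single {x : A} : x ∉ c → x ∉ r → SWellFormed c r [x]
  | wrap {a b : A} {u : List A} : a ∈ c → b ∈ r → SWellFormed c r u →
      SWellFormed c r (a :: u ++ [b])
  | concat {u v : List A} : SWellFormed c r u → SWellFormed c r v →
      SWellFormed c r (u ++ v)

/-- The matching relation `μ^s` of the nested word determined by the string
`w` (positions `0`-based): `(i,j) ∈ μ^s` iff `i < j`, `λ(i) ∈ Σ_c^s`,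
`λ(j) ∈ Σ_r^s` and `λ(i+1) … λ(j-1)` is `s`-well formed. -/
def Matched {K : ℕ} {A : Type} (h : CRAlphabet K A) (w : List A) (s : Fin K)
    (i j : ℕ) : Prop :=
  i < j ∧ j < w.length ∧
  (∃ a, w[i]? = some a ∧ a ∈ h.callSet s) ∧
  (∃ b, w[j]? = some b ∧ b ∈ h.retSet s) ∧
  SWellFormed (h.callSet s) (h.retSet s) ((w.take j).drop (i + 1))

/-- The full matching relation `μ = ⋃_s μ^s`. -/
def MuAny {K : ℕ} {A : Type} (h : CRAlphabet K A) (w : List A) (i j : ℕ) : Prop :=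
  ∃ s, Matched h w s i j

/-- A multi-stack visibly pushdown automaton over a `K`-stack call-return
alphabet, with states `Q` and stack alphabet `Γ` (the bottom symbol `⊥` is
represented implicitly: a stack contents is a list over `Γ`, the empty list
standing for the stack containing only `⊥`; in pop transitions the stack
symbol `none` stands for `⊥`). -/
structure MVPA (K : ℕ) (A Q Γ : Type) where
  pushT : Q → A → Γ → Q → Prop
  popT : Q → A → Option Γ → Q → Prop
  intT : Q → A → Q → Prop
  qI : Set Q
  qF : Set Q

/-- One step of the MVPA `M` reading letter `a`, from configuration `c` to
configuration `c'` (a configuration is a state together with one stack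
contents per stack). -/
def vStep {K : ℕ} {A Q Γ : Type} (h : CRAlphabet K A) (M : MVPA K A Q Γ)
    (a : A) (c c' : Q × (Fin K → List Γ)) : Prop :=
  (∃ s, h.kind a = .call s ∧ ∃ g, M.pushT c.1 a g c'.1 ∧
     c'.2 s = g :: c.2 s ∧ ∀ t, t ≠ s → c'.2 t = c.2 t) ∨
  (∃ s, h.kind a = .ret s ∧ (∀ t, t ≠ s → c'.2 t = c.2 t) ∧
     ((∃ g, M.popT c.1 a (some g) c'.1 ∧ c.2 s = g :: c'.2 s) ∨
      (M.popT c.1 a none c'.1 ∧ c.2 s = [] ∧ c'.2 s = []))) ∨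
  (h.kind a = .int ∧ M.intT c.1 a c'.1 ∧ c'.2 = c.2)

/-- The MVPA `M` accepts the string `w`: some run starting in an initial state
with all stacks empty and ending in a final state. -/
def vAccepts {K : ℕ} {A Q Γ : Type} (h : CRAlphabet K A) (M : MVPA K A Q Γ)
    (w : List A) : Prop :=
  ∃ f : ℕ → Q × (Fin K → List Γ),
    (f 0).1 ∈ M.qI ∧ (∀ s, (f 0).2 s = []) ∧
    (∀ i a, w[i]? = some a → vStep h M a (f i) (f (i + 1))) ∧
    (f w.length).1 ∈ M.qF

/-- The language of the MVPA `M` (nonempty strings, identified with their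
nested words). -/
def vLang {K : ℕ} {A Q Γ : Type} (h : CRAlphabet K A) (M : MVPA K A Q Γ) :
    Set (List A) :=
  {w | w ≠ [] ∧ vAccepts h M w}

/-- The letters of the 2-stack call-return alphabet with `Σ_c^1 = {a}`,
`Σ_r^1 = {ā}`, `Σ_c^2 = {b}`, `Σ_r^2 = {b̄}`, `Σ_int = ∅`. -/
inductive L2 where
  | a | abar | b | bbar
deriving DecidableEq

def h2 : CRAlphabet 2 L2 :=
  ⟨fun x => match x with
    | .a => .call 0 | .abar => .ret 0
    | .b => .call 1 | .bbar => .ret 1⟩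

/-! ### Runs of a multi-stack automaton as a relation between configurations -/

section Runs

variable {K : ℕ} {A Q Γ : Type}

/-- `Runs h M w c c'`: the automaton `M` can go from `c` to `c'` by reading `w`. -/
def Runs (h : CRAlphabet K A) (M : MVPA K A Q Γ) :
    List A → Q × (Fin K → List Γ) → Q × (Fin K → List Γ) → Prop
  | [], c, c' => c' = c
  | a :: w, c, c' => ∃ d, vStep h M a c d ∧ Runs h M w d c'

theorem runs_append {h : CRAlphabet K A} {M : MVPA K A Q Γ} (u v : List A)
    (c c' : Q × (Fin K → List Γ)) :
    Runs h M (u ++ v) c c' ↔ ∃ d, Runs h M u c d ∧ Runs h M v d c' := by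
  induction u generalizing c with
  | nil => simp [Runs]
  | cons a u ih =>
    simp only [List.cons_append, Runs, ih]
    constructor
    · rintro ⟨d, hd, e, he, hv⟩
      exact ⟨e, ⟨d, hd, he⟩, hv⟩
    · rintro ⟨e, ⟨d, hd, he⟩, hv⟩
      exact ⟨d, hd, e, he, hv⟩

theorem runs_of_steps {h : CRAlphabet K A} {M : MVPA K A Q Γ} (w : List A)
    (f : ℕ → Q × (Fin K → List Γ))
    (hf : ∀ i a, w[i]? = some a → vStep h M a (f i) (f (i + 1))) :
    Runs h M w (f 0) (f w.length) := by
  induction w generalizing f with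
  | nil => rfl
  | cons a w ih =>
    exact ⟨f 1, hf 0 a (by simp), ih (fun i => f (i + 1)) fun i b hb => hf (i + 1) b (by simpa)⟩

theorem exists_steps_of_runs {h : CRAlphabet K A} {M : MVPA K A Q Γ} (w : List A)
    (c c' : Q × (Fin K → List Γ)) (hr : Runs h M w c c') :
    ∃ f : ℕ → Q × (Fin K → List Γ), f 0 = c ∧ f w.length = c' ∧
      ∀ i a, w[i]? = some a → vStep h M a (f i) (f (i + 1)) := by
  induction w generalizing c with
  | nil => exact ⟨fun _ => c, rfl, hr.symm, by simp⟩
  | cons a w ih =>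
    obtain ⟨d, hd, hr⟩ := hr
    obtain ⟨f, rfl, rfl, hf⟩ := ih d hr
    refine ⟨fun i => Nat.casesOn i c f, rfl, rfl, fun i b hb => ?_⟩
    cases i with
    | zero =>
      obtain rfl : a = b := by simpa using hb
      exact hd
    | succ i => exact hf i b (by simpa using hb)

theorem vAccepts_iff_runs (h : CRAlphabet K A) (M : MVPA K A Q Γ) (w : List A) :
    vAccepts h M w ↔ ∃ q ∈ M.qI, ∃ c', Runs h M w (q, fun _ => []) c' ∧ c'.1 ∈ M.qF := by
  constructor
  · rintro ⟨f, hI, h0, hs, hF⟩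
    have : f 0 = ((f 0).1, fun _ => []) := Prod.ext rfl (funext h0)
    exact ⟨_, hI, _, this ▸ runs_of_steps w f hs, hF⟩
  · rintro ⟨q, hq, c', hr, hF⟩
    obtain ⟨f, h0, hl, hs⟩ := exists_steps_of_runs w _ _ hr
    exact ⟨f, by simpa [h0], by simp [h0], hs, by simpa [hl]⟩

/-- The stack heights reached after reading a word do not depend on the automaton. -/
theorem runs_height_eq {Q' Γ' : Type} {h : CRAlphabet K A} {M : MVPA K A Q Γ}
    {M' : MVPA K A Q' Γ'} (w : List A) (c c' : Q × (Fin K → List Γ))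
    (d d' : Q' × (Fin K → List Γ')) (hcd : ∀ s, (c.2 s).length = (d.2 s).length)
    (hc : Runs h M w c c') (hd : Runs h M' w d d') (s : Fin K) :
    (c'.2 s).length = (d'.2 s).length := by
  induction w generalizing c d with
  | nil =>
    obtain rfl := hc
    obtain rfl := hd
    exact hcd s
  | cons a w ih =>
    obtain ⟨c₁, hc₁, hc⟩ := hc
    obtain ⟨d₁, hd₁, hd⟩ := hd
    refine ih c₁ d₁ (fun t => ?_) hc hd
    have ht := hcd t
    have key : ∀ {Q Γ : Type} {M : MVPA K A Q Γ} {c c' : Q × (Fin K → List Γ)},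
        vStep h M a c c' → (c'.2 t).length =
          match h.kind a with
          | .call s => if t = s then (c.2 t).length + 1 else (c.2 t).length
          | .ret s => if t = s then (c.2 t).length - 1 else (c.2 t).length
          | .int => (c.2 t).length := by
      rintro Q Γ M c c' (⟨s, hk, g, -, hs, ho⟩ | ⟨s, hk, ho, hp⟩ | ⟨hk, -, he⟩)
      · by_cases hts : t = s
        · subst hts; simp [hk, hs]
        · simp [hk, hts, ho t hts]
      · by_cases hts : t = s
        · subst hts
          rcases hp with ⟨g, -, hg⟩ | ⟨-, h₁, h₂⟩
          · simp [hk, hg]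
          · simp [hk, h₁, h₂]
        · simp [hk, hts, ho t hts]
      · simp [hk, he]
    rw [key hc₁, key hd₁, ht]

end Runs

/-! ### Steps over the alphabet `h2` -/

section Steps

variable {Q Γ : Type}

/-- The configuration with state `q` and stack contents `s` and `t`. -/
def cfg (q : Q) (s t : List Γ) : Q × (Fin 2 → List Γ) := (q, ![s, t])

theorem eq_cfg_iff (c : Q × (Fin 2 → List Γ)) (q : Q) (s t : List Γ) :
    c = cfg q s t ↔ c.1 = q ∧ c.2 0 = s ∧ c.2 1 = t := by
  constructor
  · rintro rfl
    simp [cfg]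
  · rintro ⟨rfl, rfl, rfl⟩
    refine Prod.ext rfl (funext fun i => ?_)
    fin_cases i <;> rfl

variable (M : MVPA 2 L2 Q Γ) (q : Q) (s t : List Γ) (c : Q × (Fin 2 → List Γ))

theorem vStep_a : vStep h2 M .a (cfg q s t) c ↔
    ∃ g q', M.pushT q .a g q' ∧ c = cfg q' (g :: s) t := by
  simp [vStep, h2, eq_cfg_iff]
  simp [cfg]

theorem vStep_b : vStep h2 M .b (cfg q s t) c ↔
    ∃ g q', M.pushT q .b g q' ∧ c = cfg q' s (g :: t) := by
  simp [vStep, h2, eq_cfg_iff]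
  simp [cfg]
  grind

theorem vStep_abar : vStep h2 M .abar (cfg q s t) c ↔
    (∃ g q' s', M.popT q .abar (some g) q' ∧ s = g :: s' ∧ c = cfg q' s' t) ∨
      ∃ q', M.popT q .abar none q' ∧ s = [] ∧ c = cfg q' [] t := by
  simp [vStep, h2, eq_cfg_iff]
  simp [cfg]
  grind

theorem vStep_bbar : vStep h2 M .bbar (cfg q s t) c ↔
    (∃ g q' t', M.popT q .bbar (some g) q' ∧ t = g :: t' ∧ c = cfg q' s t') ∨
      ∃ q', M.popT q .bbar none q' ∧ t = [] ∧ c = cfg q' s [] := by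
  simp [vStep, h2, eq_cfg_iff]
  simp [cfg]
  grind

end Steps

/-! ### An automaton detecting a difference between two Boolean matrices

Stack `0` holds one marked or unmarked item per column, stack `1` one recorded bit per row. -/

/-- Stack symbols: column items, and bits recorded for rows. -/
inductive StackSym where
  | item (m : Bool)
  | bit (v : Bool)
deriving Fintype

/-- States of the automaton. The Boolean `acc` says whether the current row has a one in a marked
column; `moveR` and `moveL` hold an item in transit between the stacks. -/
inductive St where
  | scan (acc : Bool)
  | moveR (acc m : Bool)
  | moveL (acc m : Bool)
  | found
deriving Fintype

/-- The automaton marks an arbitrary set of columns, records for every row of the first matrix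
whether it has a one in a marked column, and looks for a row of the second matrix for which the
answer is different. -/
def diffAut : MVPA 2 L2 St StackSym where
  pushT q x g q' := match q, x with
    | .scan acc, .a => (∃ m, g = .item m) ∧ q' = .scan acc
    | .scan acc, .b => g = .bit acc ∧ q' = .scan false
    | .moveR acc m, .a => g = .item m ∧ q' = .scan (acc || m)
    | .moveR acc m, .b => g = .item m ∧ q' = .scan acc
    | .moveL acc m, .a => g = .item m ∧ q' = .scan acc
    | .found, _ => q' = .found
    | _, _ => False
  popT q x g q' := match q, x, g with
    | .scan acc, .abar, some (.item m) => q' = .moveR acc m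
    | .scan acc, .bbar, some (.item m) => q' = .moveL acc m
    | .scan acc, .bbar, some (.bit v) => q' = if v = acc then .scan false else .found
    | .found, _, _ => q' = .found
    | _, _, _ => False
  intT _ _ _ := False
  qI := {.scan false}
  qF := {.found}

/-- Code of one matrix entry. -/
def cellWord (x : Bool) : List L2 :=
  if x then [.abar, .a, .abar, .b] else [.abar, .b]

/-- Code of a row: move all items to stack `1`, spelling the entries, and move them back. -/
def rowWord (xs : List Bool) : List L2 :=
  xs.flatMap cellWord ++ (List.replicate xs.length [L2.bbar, L2.a]).flatten

/-- Code of the first matrix, with `n` columns. -/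
def fstWord (n : ℕ) (G : List (List Bool)) : List L2 :=
  List.replicate n .a ++ G.flatMap fun xs => rowWord xs ++ [.b]

/-- Code of the second matrix, its rows being listed from the last to the first. -/
def sndWord (G : List (List Bool)) : List L2 :=
  G.reverse.flatMap fun xs => rowWord xs ++ [.bbar]

/-- Whether the row `xs` has a one in a column marked by `ms`. -/
def hits : List Bool → List Bool → Bool
  | m :: ms, x :: xs => (x && m) || hits ms xs
  | _, _ => false

local notation "Run" => Runs h2 diffAut

theorem run_found (w : List L2) (s t : List StackSym) :
    ∃ s' t', Run w (cfg .found s t) (cfg .found s' t') := by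
  induction w generalizing s t with
  | nil => exact ⟨s, t, rfl⟩
  | cons x w ih =>
    suffices ∃ s' t', vStep h2 diffAut x (cfg .found s t) (cfg .found s' t') by
      obtain ⟨s₁, t₁, h₁⟩ := this
      obtain ⟨s', t', h'⟩ := ih s₁ t₁
      exact ⟨s', t', _, h₁, h'⟩
    cases x with
    | a => exact ⟨_, _, (vStep_a ..).2 ⟨.item true, .found, rfl, rfl⟩⟩
    | b => exact ⟨_, _, (vStep_b ..).2 ⟨.item true, .found, rfl, rfl⟩⟩
    | abar =>
      cases s with
      | nil => exact ⟨_, _, (vStep_abar ..).2 (.inr ⟨.found, rfl, rfl, rfl⟩)⟩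
      | cons g s => exact ⟨_, _, (vStep_abar ..).2 (.inl ⟨g, .found, s, rfl, rfl, rfl⟩)⟩
    | bbar =>
      cases t with
      | nil => exact ⟨_, _, (vStep_bbar ..).2 (.inr ⟨.found, rfl, rfl, rfl⟩)⟩
      | cons g t => exact ⟨_, _, (vStep_bbar ..).2 (.inl ⟨g, .found, t, rfl, rfl, rfl⟩)⟩

theorem run_cellWord (acc m x : Bool) (s t : List StackSym) (c : St × (Fin 2 → List StackSym)) :
    Run (cellWord x) (cfg (.scan acc) (.item m :: s) t) c ↔
      c = cfg (.scan (acc || (x && m))) s (.item m :: t) := by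
  cases x <;> simp [cellWord, Runs, vStep_a, vStep_abar, vStep_b, diffAut, -Prod.exists]

theorem run_cells (acc : Bool) (ms xs : List Bool) (hl : ms.length = xs.length)
    (s t : List StackSym) (c : St × (Fin 2 → List StackSym)) :
    Run (xs.flatMap cellWord) (cfg (.scan acc) (ms.map .item ++ s) t) c ↔
      c = cfg (.scan (acc || hits ms xs)) s (ms.reverse.map .item ++ t) := by
  induction xs generalizing ms acc t with
  | nil =>
    obtain rfl : ms = [] := by simpa using hl
    simp [Runs, hits]
  | cons x xs ih =>
    cases ms with
    | nil => simp at hl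
    | cons m ms =>
      simp only [List.flatMap_cons, runs_append, List.map_cons, List.cons_append, run_cellWord,
        exists_eq_left, ih _ ms (by simpa using hl)]
      simp [hits, Bool.or_assoc]

theorem run_back (acc : Bool) (ms : List Bool) (s t : List StackSym)
    (c : St × (Fin 2 → List StackSym)) :
    Run (List.replicate ms.length [L2.bbar, L2.a]).flatten
        (cfg (.scan acc) s (ms.map .item ++ t)) c ↔
      c = cfg (.scan acc) (ms.reverse.map .item ++ s) t := by
  induction ms generalizing s with
  | nil => simp [Runs]
  | cons m ms ih =>
    simp only [List.length_cons, List.replicate_succ, List.flatten_cons, List.cons_append,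
      List.nil_append, List.map_cons]
    simp [Runs, vStep_bbar, vStep_a, diffAut, -Prod.exists]
    simpa [diffAut] using ih (.item m :: s)

theorem run_rowWord (ms xs : List Bool) (hl : ms.length = xs.length) (t : List StackSym)
    (c : St × (Fin 2 → List StackSym)) :
    Run (rowWord xs) (cfg (.scan false) (ms.map .item) t) c ↔
      c = cfg (.scan (hits ms xs)) (ms.map .item) t := by
  have h₁ := run_cells false ms xs hl [] t
  have h₂ := run_back (hits ms xs) ms.reverse [] t
  simp only [List.append_nil, List.length_reverse, List.reverse_reverse, Bool.false_or] at h₁ h₂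
  simp only [rowWord, runs_append, h₁, exists_eq_left, ← hl, h₂]

theorem run_replicate_a (n : ℕ) (s t : List StackSym) (c : St × (Fin 2 → List StackSym)) :
    Run (List.replicate n .a) (cfg (.scan false) s t) c ↔
      ∃ ms : List Bool, ms.length = n ∧ c = cfg (.scan false) (ms.map .item ++ s) t := by
  induction n generalizing s with
  | zero => simp [Runs]
  | succ n ih =>
    simp only [List.replicate_succ, Runs, vStep_a]
    constructor
    · rintro ⟨d, ⟨g, q', ⟨⟨m, rfl⟩, rfl⟩, rfl⟩, hr⟩
      obtain ⟨ms, rfl, rfl⟩ := (ih _).1 hr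
      exact ⟨ms ++ [m], by simp, by simp⟩
    · rintro ⟨ms, hms, rfl⟩
      obtain ⟨ms, m, rfl⟩ := List.eq_nil_or_concat ms |>.resolve_left (by rintro rfl; simp at hms)
      exact ⟨_, ⟨_, _, ⟨⟨m, rfl⟩, rfl⟩, rfl⟩, (ih _).2 ⟨ms, by simpa using hms, by simp⟩⟩

theorem run_pushRows (ms : List Bool) (G : List (List Bool))
    (hG : ∀ xs ∈ G, ms.length = xs.length) (t : List StackSym) (c : St × (Fin 2 → List StackSym)) :
    Run (G.flatMap fun xs => rowWord xs ++ [.b]) (cfg (.scan false) (ms.map .item) t) c ↔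
      c = cfg (.scan false) (ms.map .item) ((G.reverse.map (hits ms)).map .bit ++ t) := by
  induction G generalizing t with
  | nil => simp [Runs]
  | cons xs G ih =>
    simp only [List.mem_cons, forall_eq_or_imp] at hG
    have hb (v : Bool) (s : List StackSym) (d : St × (Fin 2 → List StackSym)) :
        Run [.b] (cfg (.scan v) s t) d ↔ d = cfg (.scan false) s (.bit v :: t) := by
      simp [Runs, vStep_b, diffAut]
    simp only [List.flatMap_cons, runs_append, run_rowWord ms xs hG.1, exists_eq_left, hb,
      ih hG.2]
    simp

theorem run_fstWord (n : ℕ) (G : List (List Bool)) (hG : ∀ xs ∈ G, xs.length = n)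
    (c : St × (Fin 2 → List StackSym)) :
    Run (fstWord n G) (cfg (.scan false) [] []) c ↔
      ∃ ms : List Bool, ms.length = n ∧
        c = cfg (.scan false) (ms.map .item) ((G.reverse.map (hits ms)).map .bit) := by
  simp only [fstWord, runs_append, run_replicate_a]
  constructor
  · rintro ⟨d, ⟨ms, rfl, rfl⟩, hr⟩
    rw [List.append_nil, run_pushRows ms G fun xs h => (hG xs h).symm] at hr
    exact ⟨ms, rfl, by simpa using hr⟩
  · rintro ⟨ms, rfl, rfl⟩
    refine ⟨_, ⟨ms, rfl, rfl⟩, ?_⟩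
    rw [List.append_nil, run_pushRows ms G fun xs h => (hG xs h).symm]
    simp

theorem run_popRow (ms xs : List Bool) (hl : ms.length = xs.length) (v : Bool) (t : List StackSym)
    (c : St × (Fin 2 → List StackSym)) :
    Run (rowWord xs ++ [.bbar]) (cfg (.scan false) (ms.map .item) (.bit v :: t)) c ↔
      c = cfg (if v = hits ms xs then .scan false else .found) (ms.map .item) t := by
  rw [runs_append]
  simp only [run_rowWord ms xs hl, exists_eq_left]
  simp [Runs, vStep_bbar, diffAut]

theorem run_popRows_eq (ms : List Bool) (G : List (List Bool))
    (hG : ∀ xs ∈ G, ms.length = xs.length) (c : St × (Fin 2 → List StackSym))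
    (hr : Run (G.flatMap fun xs => rowWord xs ++ [.bbar])
      (cfg (.scan false) (ms.map .item) ((G.map (hits ms)).map .bit)) c) :
    c.1 = .scan false := by
  induction G with
  | nil =>
    obtain rfl := hr
    rfl
  | cons xs G ih =>
    simp only [List.mem_cons, forall_eq_or_imp] at hG
    rw [List.flatMap_cons, runs_append] at hr
    obtain ⟨d, hd, hr⟩ := hr
    rw [List.map_cons, List.map_cons, run_popRow ms xs hG.1, if_pos rfl] at hd
    subst hd
    exact ih hG.2 hr

theorem run_popRows_ne (ms : List Bool) (G : List (List Bool))
    (hG : ∀ xs ∈ G, ms.length = xs.length) (vs : List Bool) (hl : vs.length = G.length)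
    (hne : vs ≠ G.map (hits ms)) :
    ∃ s t, Run (G.flatMap fun xs => rowWord xs ++ [.bbar])
      (cfg (.scan false) (ms.map .item) (vs.map .bit)) (cfg .found s t) := by
  induction G generalizing vs with
  | nil =>
    obtain rfl : vs = [] := by simpa using hl
    simp at hne
  | cons xs G ih =>
    simp only [List.mem_cons, forall_eq_or_imp] at hG
    cases vs with
    | nil => simp at hl
    | cons v vs =>
      simp only [List.flatMap_cons, runs_append (_ ++ _), List.map_cons, run_popRow ms xs hG.1,
        exists_eq_left]
      split_ifs with hv
      · exact ih hG.2 vs (by simpa using hl) (by simpa [hv] using hne)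
      · exact run_found ..

theorem hits_replicate_false (n : ℕ) (xs : List Bool) :
    hits (List.replicate n false) xs = false := by
  induction n generalizing xs with
  | zero => rfl
  | succ n ih => cases xs <;> simp [List.replicate_succ, hits, ih]

theorem exists_hits_ne (xs ys : List Bool) (hl : xs.length = ys.length) (hne : xs ≠ ys) :
    ∃ ms : List Bool, ms.length = xs.length ∧ hits ms xs ≠ hits ms ys := by
  induction xs generalizing ys with
  | nil => simp_all [eq_comm]
  | cons x xs ih =>
    cases ys with
    | nil => simp at hl
    | cons y ys =>
      by_cases hxy : x = y
      · obtain ⟨ms, h₁, h₂⟩ := ih ys (by simpa using hl) (by simpa [hxy] using hne)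
        exact ⟨false :: ms, by simp [h₁], by simpa [hits] using h₂⟩
      · exact ⟨true :: List.replicate xs.length false, by simp,
          by simpa [hits, hits_replicate_false] using hxy⟩

theorem exists_map_hits_ne (n : ℕ) (G H : List (List Bool)) (hG : ∀ xs ∈ G, xs.length = n)
    (hH : ∀ xs ∈ H, xs.length = n) (hl : G.length = H.length) (hne : G ≠ H) :
    ∃ ms : List Bool, ms.length = n ∧ G.map (hits ms) ≠ H.map (hits ms) := by
  by_contra! hall
  refine hne (List.ext_getElem hl fun i hi hi' => ?_)
  by_contra hi_ne
  have hGi := hG _ (List.getElem_mem hi)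
  obtain ⟨ms, hms, hms_ne⟩ :=
    exists_hits_ne G[i] H[i] (hGi.trans (hH _ (List.getElem_mem hi')).symm) hi_ne
  have := congrArg (·[i]?) (hall ms (hms.trans hGi))
  simp [hi, hi'] at this
  exact hms_ne this

theorem diffAut_accepts_iff (w : List L2) :
    vAccepts h2 diffAut w ↔ ∃ c, Run w (cfg (.scan false) [] []) c ∧ c.1 = .found := by
  have : (fun _ : Fin 2 => ([] : List StackSym)) = ![[], []] := by
    funext i
    fin_cases i <;> rfl
  simp [vAccepts_iff_runs, diffAut, cfg, this]

theorem not_accepts_diagonal (n : ℕ) (G : List (List Bool)) (hG : ∀ xs ∈ G, xs.length = n) :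
    ¬ vAccepts h2 diffAut (fstWord n G ++ sndWord G) := by
  rw [diffAut_accepts_iff]
  rintro ⟨c, hr, hc⟩
  obtain ⟨d, hd, hr⟩ := (runs_append ..).1 hr
  obtain ⟨ms, rfl, rfl⟩ := (run_fstWord n G hG d).1 hd
  have := run_popRows_eq ms G.reverse (fun xs h => (hG xs (by simpa using h)).symm) c hr
  simp [hc] at this

theorem accepts_of_ne (n : ℕ) (G H : List (List Bool)) (hG : ∀ xs ∈ G, xs.length = n)
    (hH : ∀ xs ∈ H, xs.length = n) (hl : G.length = H.length) (hne : G ≠ H) :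
    vAccepts h2 diffAut (fstWord n G ++ sndWord H) := by
  rw [diffAut_accepts_iff]
  obtain ⟨ms, rfl, hms⟩ := exists_map_hits_ne n G H hG hH hl hne
  obtain ⟨s, t, hr⟩ := run_popRows_ne ms H.reverse (fun xs h => (hH xs (by simpa using h)).symm)
    (G.reverse.map (hits ms)) (by simpa) (by simpa using hms)
  exact ⟨_, (runs_append ..).2 ⟨_, (run_fstWord _ G hG _).2 ⟨ms, rfl, rfl⟩, hr⟩, rfl⟩

/-! ### The cut between the two matrices -/

/-- Whatever the automaton, the stack heights after the first matrix are its dimensions. -/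
theorem height_fstWord {Q Γ : Type} (M : MVPA 2 L2 Q Γ) (n : ℕ) (G : List (List Bool))
    (hG : ∀ xs ∈ G, xs.length = n) (q : Q) (c : Q × (Fin 2 → List Γ))
    (hr : Runs h2 M (fstWord n G) (q, fun _ => []) c) :
    (c.2 0).length = n ∧ (c.2 1).length = G.length := by
  have hd := (run_fstWord n G hG _).2 ⟨List.replicate n false, by simp, rfl⟩
  have key := runs_height_eq _ _ _ _ _ (fun s => by fin_cases s <;> rfl) hr hd
  exact ⟨by simpa [cfg] using key 0, by simpa [cfg] using key 1⟩

theorem exists_mul_pow_lt (q g : ℕ) : ∃ n, 0 < n ∧ q * (g ^ n * g ^ n) < (2 ^ n) ^ n := by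
  refine ⟨2 * g + q + 1, by omega, ?_⟩
  set n := 2 * g + q + 1 with hn
  calc q * (g ^ n * g ^ n) ≤ 2 ^ q * ((2 ^ g) ^ n * (2 ^ g) ^ n) := by
        gcongr <;> exact Nat.lt_two_pow_self.le
    _ = 2 ^ (q + 2 * g * n) := by rw [← pow_mul, ← pow_add, ← pow_add]; ring_nf
    _ < 2 ^ (n * n) := by
        apply Nat.pow_lt_pow_right (by norm_num)
        nlinarith
    _ = (2 ^ n) ^ n := pow_mul ..

theorem diffAut_compl_not_recognized {Q Γ : Type} [Fintype Q] [Fintype Γ] (M : MVPA 2 L2 Q Γ) :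
    vLang h2 M ≠ {w : List L2 | w ≠ []} \ vLang h2 diffAut := by
  intro hM
  obtain ⟨n, hn, hlt⟩ := exists_mul_pow_lt (Fintype.card Q) (Fintype.card Γ)
  have hne (G H : List (List Bool)) : fstWord n G ++ sndWord H ≠ [] := by
    simp [fstWord, hn.ne']
  let rows (G : List.Vector (List.Vector Bool n) n) : List (List Bool) := G.1.map Subtype.val
  have hrows (G) : ∀ xs ∈ rows G, xs.length = n := by
    intro xs hxs
    obtain ⟨v, -, rfl⟩ := List.mem_map.1 hxs
    exact v.2
  have hlen (G) : (rows G).length = n := (List.length_map _).trans G.2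
  have hcut (G) : ∃ q ∈ M.qI, ∃ c, Runs h2 M (fstWord n (rows G)) (q, fun _ => []) c ∧
      ∃ c', Runs h2 M (sndWord (rows G)) c c' ∧ c'.1 ∈ M.qF := by
    have hmem : fstWord n (rows G) ++ sndWord (rows G) ∈ vLang h2 M := by
      rw [hM]
      exact ⟨hne _ _, fun h => not_accepts_diagonal n _ (hrows G) h.2⟩
    obtain ⟨q, hq, c', hr, hF⟩ := (vAccepts_iff_runs ..).1 hmem.2
    obtain ⟨c, h₁, h₂⟩ := (runs_append ..).1 hr
    exact ⟨q, hq, c, h₁, c', h₂, hF⟩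
  choose q hq c hfst c' hsnd hF using hcut
  have hht (G) : ((c G).2 0).length = n ∧ ((c G).2 1).length = n := by
    simpa only [hlen] using height_fstWord M n _ (hrows G) _ _ (hfst G)
  let cut (G : List.Vector (List.Vector Bool n) n) : Q × List.Vector Γ n × List.Vector Γ n :=
    ((c G).1, ⟨_, (hht G).1⟩, ⟨_, (hht G).2⟩)
  obtain ⟨G, H, hGH, hcutGH⟩ := Fintype.exists_ne_map_eq_of_card_lt cut (by simpa using hlt)
  have hc : c G = c H := by
    obtain ⟨h₁, h₂⟩ := Prod.mk.inj hcutGH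
    obtain ⟨h₂, h₃⟩ := Prod.mk.inj h₂
    exact ((eq_cfg_iff ..).2 ⟨h₁, congrArg Subtype.val h₂, congrArg Subtype.val h₃⟩).trans
      ((eq_cfg_iff ..).2 ⟨rfl, rfl, rfl⟩).symm
  have hmem : fstWord n (rows G) ++ sndWord (rows H) ∈ vLang h2 M :=
    ⟨hne _ _, (vAccepts_iff_runs ..).2
      ⟨q G, hq G, c' H, (runs_append ..).2 ⟨c G, hfst G, hc ▸ hsnd H⟩, hF H⟩⟩
  rw [hM] at hmem
  refine hmem.2 ⟨hne _ _, accepts_of_ne n _ _ (hrows G) (hrows H) (by simp [hlen]) fun h => hGH ?_⟩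
  exact Subtype.ext (List.map_injective_iff.2 Subtype.val_injective h)

/-- 2VPA are not closed under complementation: over the 2-stack
call-return alphabet with `Σ_c^1={a}`, `Σ_r^1={ā}`, `Σ_c^2={b}`,
`Σ_r^2={b̄}`, `Σ_int=∅` there is a set `L` of nested words recognized by some
2VPA whose complement (relative to all nested words) is recognized by no
2VPA. -/
theorem stmt18 :
    ∃ L : Set (List L2), (∀ w ∈ L, w ≠ []) ∧
      (∃ (Q Γ : Type) (_ : Fintype Q) (_ : Fintype Γ) (M : MVPA 2 L2 Q Γ),
        vLang h2 M = L) ∧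
      ¬ (∃ (Q Γ : Type) (_ : Fintype Q) (_ : Fintype Γ) (M : MVPA 2 L2 Q Γ),
        vLang h2 M = {w : List L2 | w ≠ []} \ L) := by
  exact ⟨vLang h2 diffAut, fun _ h => h.1,
    ⟨St, StackSym, inferInstance, inferInstance, diffAut, rfl⟩,
    fun ⟨_, _, _, _, M, hM⟩ => diffAut_compl_not_recognized M hM⟩
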